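/- Let n ≥ 2, let Λ be a compact metric space, f : Λ → Λ a homeomorphism, and S : Λ → 𝒮ⁿ continuous; write Ŝ_x := Q S_x Q, S^k_x := S_{f^{k−1}(x)}⋯S_x and Ŝ^k_x := Ŝ_{f^{k−1}(x)}⋯Ŝ_x. Suppose that for each x ∈ Λ there are nonzero subspaces N¹_x, N²_x of N with N = N¹_x ⊕ N²_x such that: (i) Ŝ_x(N¹_x) = N¹_{f(x)} and Ŝ_x is injective on N¹_x; (ii) Ŝ_x(N²_x) ⊆ N²_{f(x)}; (iii) the splitting is continuous, in the sense that the projection of N onto N¹_x along N²_x depends continuously on x; (iv) there is m ∈ ℕ such that for every x ∈ Λ, sup{‖Ŝ^m_x w‖ : w ∈ N²_x, ‖w‖ = 1} ≤ (1/2)·inf{‖Ŝ^m_x v‖ : v ∈ N¹_x, ‖v‖ = 1}. Then, setting F¹_x := ℝu ⊕ N¹_x, there exists a family of subspaces F²_x ⊆ ℝu ⊕ N²_x (x ∈ Λ) such that: ℝⁿ = F¹_x ⊕ F²_x for every x; S_x(F¹_x) ⊆ F¹_{f(x)} and S_x(F²_x) ⊆ F²_{f(x)}; the projection of ℝⁿ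 onto F²_x along F¹_x depends continuously on x; and there exists m′ ∈ ℕ such that for every x ∈ Λ, S^{m′}_x is injective on F¹_x and sup{‖S^{m′}_x w‖ : w ∈ F²_x, ‖w‖ = 1} ≤ (1/2)·inf{‖S^{m′}_x v‖ : v ∈ F¹_x, ‖v‖ = 1}. -/

import Mathlib

open Matrix Filter Topology

/-- `S` is a row-stochastic matrix: all entries in `[0,1]` and each row sums to `1`. -/
def IsStochastic {n : ℕ} (S : Matrix (Fin n) (Fin n) ℝ) : Prop :=
  (∀ i j, 0 ≤ S i j ∧ S i j ≤ 1) ∧ ∀ i, ∑ j, S i j = 1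

/-- The unit vector `u = (1/√n, …, 1/√n)`. -/
noncomputable def uvec (n : ℕ) : Fin n → ℝ := fun _ => 1 / Real.sqrt n

/-- The orthogonal projection onto the line `ℝu`, i.e. `(1/n)·J` with `J` the all-ones matrix. -/
noncomputable def Pmat (n : ℕ) : Matrix (Fin n) (Fin n) ℝ := Matrix.of fun _ _ => (1 : ℝ) / n

/-- The orthogonal projection `Q = I − P` onto the hyperplane `N = {v : ∑ᵢ vᵢ = 0}`. -/
noncomputable def Qmat (n : ℕ) : Matrix (Fin n) (Fin n) ℝ := 1 - Pmat n

/-- `ℝⁿ` with the Euclidean norm. -/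
noncomputable def toE {n : ℕ} (v : Fin n → ℝ) : EuclideanSpace ℝ (Fin n) :=
  (EuclideanSpace.equiv (Fin n) ℝ).symm v

/-- The operator norm of a matrix induced by the Euclidean norm on `ℝⁿ`. -/
noncomputable def opNorm {n : ℕ} (S : Matrix (Fin n) (Fin n) ℝ) : ℝ :=
  ‖LinearMap.toContinuousLinearMap (Matrix.toEuclideanLin S)‖

/-- The hyperplane `N = {v ∈ ℝⁿ : ∑ᵢ vᵢ = 0}`. -/
noncomputable def Nhyp (n : ℕ) : Submodule ℝ (Fin n → ℝ) :=
  LinearMap.ker (∑ i : Fin n, (LinearMap.proj i : (Fin n → ℝ) →ₗ[ℝ] ℝ))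

/-- Logarithm with values in `EReal`, with the convention `log 0 = −∞`. -/
noncomputable def elog (r : ℝ) : EReal := if r ≤ 0 then ⊥ else ((Real.log r : ℝ) : EReal)

/-- The cocycle iterates `S^k_x = S_{f^{k−1}(x)} ⋯ S_{f(x)} S_x`. -/
noncomputable def cocycle {n : ℕ} {X : Type*} (f : X → X) (S : X → Matrix (Fin n) (Fin n) ℝ) :
    ℕ → X → Matrix (Fin n) (Fin n) ℝ
  | 0, _ => 1
  | k + 1, x => S (f^[k] x) * cocycle f S k x

/-- The ordered product `prodA S k = S_{k−1} ⋯ S_1 S_0`. -/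
noncomputable def prodA {n : ℕ} (S : ℕ → Matrix (Fin n) (Fin n) ℝ) :
    ℕ → Matrix (Fin n) (Fin n) ℝ
  | 0 => 1
  | k + 1 => S k * prodA S k

lemma norm_le_norm_toE {n : ℕ} (v : Fin n → ℝ) : ‖v‖ ≤ ‖toE v‖ :=
  (pi_norm_le_iff_of_nonneg (norm_nonneg _)).2 fun i => PiLp.norm_apply_le (toE v) i

lemma norm_toE_le {n : ℕ} (v : Fin n → ℝ) : ‖toE v‖ ≤ √n * ‖v‖ := by
  rw [EuclideanSpace.norm_eq]
  refine Real.sqrt_le_iff.2 ⟨by positivity, ?_⟩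
  rw [mul_pow, Real.sq_sqrt (Nat.cast_nonneg n)]
  calc ∑ i, ‖(toE v) i‖ ^ 2 ≤ ∑ _i : Fin n, ‖v‖ ^ 2 :=
        Finset.sum_le_sum fun i _ => pow_le_pow_left₀ (norm_nonneg _) (norm_le_pi_norm v i) 2
    _ = n * ‖v‖ ^ 2 := by simp

lemma toE_smul {n : ℕ} (c : ℝ) (v : Fin n → ℝ) : toE (c • v) = c • toE v :=
  map_smul (EuclideanSpace.equiv (Fin n) ℝ).symm c v

lemma toE_zero {n : ℕ} : toE (0 : Fin n → ℝ) = 0 :=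
  map_zero (EuclideanSpace.equiv (Fin n) ℝ).symm

lemma norm_toE_pos {n : ℕ} {v : Fin n → ℝ} (hv : v ≠ 0) : 0 < ‖toE v‖ :=
  (norm_pos_iff.2 hv).trans_le (norm_le_norm_toE v)

lemma IsStochastic.norm_mulVec_le {n : ℕ} {S : Matrix (Fin n) (Fin n) ℝ} (hS : IsStochastic S)
    (v : Fin n → ℝ) : ‖S *ᵥ v‖ ≤ ‖v‖ := by
  refine (pi_norm_le_iff_of_nonneg (norm_nonneg _)).2 fun i => ?_
  calc ‖(S *ᵥ v) i‖ ≤ ∑ j, ‖S i j * v j‖ := by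
        rw [mulVec, dotProduct]
        exact norm_sum_le _ _
    _ ≤ ∑ j, S i j * ‖v‖ := Finset.sum_le_sum fun j _ => by
        rw [norm_mul, Real.norm_of_nonneg (hS.1 i j).1]
        exact mul_le_mul_of_nonneg_left (norm_le_pi_norm v j) (hS.1 i j).1
    _ = ‖v‖ := by rw [← Finset.sum_mul, hS.2 i, one_mul]

lemma isStochastic_Pmat {n : ℕ} (hn : n ≠ 0) : IsStochastic (Pmat n) := by
  have h : (1 : ℝ) ≤ n := by exact_mod_cast Nat.one_le_iff_ne_zero.2 hn
  refine ⟨fun i j => ?_, fun i => ?_⟩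
  · simp only [Pmat, of_apply]
    exact ⟨by positivity, (div_le_one (by linarith)).2 h⟩
  · simp only [Pmat, of_apply, Finset.sum_const, Finset.card_univ, Fintype.card_fin, nsmul_eq_mul]
    field_simp

lemma IsStochastic.mul_Pmat {n : ℕ} {S : Matrix (Fin n) (Fin n) ℝ} (hS : IsStochastic S) :
    S * Pmat n = Pmat n := by
  ext i j
  simp only [mul_apply, Pmat, of_apply]
  rw [← Finset.sum_mul, hS.2 i, one_mul]

lemma Qmat_mul_Pmat {n : ℕ} (hn : n ≠ 0) : Qmat n * Pmat n = 0 := by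
  rw [Qmat, sub_mul, one_mul, (isStochastic_Pmat hn).mul_Pmat, sub_self]

lemma Pmat_mul_Qmat {n : ℕ} (hn : n ≠ 0) : Pmat n * Qmat n = 0 := by
  rw [Qmat, mul_sub, mul_one, (isStochastic_Pmat hn).mul_Pmat, sub_self]

lemma Qmat_mulVec {n : ℕ} (v : Fin n → ℝ) : Qmat n *ᵥ v = v - Pmat n *ᵥ v := by
  rw [Qmat, sub_mulVec, one_mulVec]

lemma norm_Qmat_mulVec_le {n : ℕ} (hn : n ≠ 0) (v : Fin n → ℝ) : ‖Qmat n *ᵥ v‖ ≤ 2 * ‖v‖ := by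
  rw [Qmat_mulVec]
  linarith [norm_sub_le v (Pmat n *ᵥ v), (isStochastic_Pmat hn).norm_mulVec_le v]

lemma Pmat_mulVec_apply {n : ℕ} (v : Fin n → ℝ) (i : Fin n) :
    (Pmat n *ᵥ v) i = (∑ j, v j) / n := by
  simp only [mulVec, dotProduct, Pmat, of_apply]
  rw [← Finset.mul_sum, one_div_mul_eq_div]

lemma mem_Nhyp_iff {n : ℕ} (v : Fin n → ℝ) : v ∈ Nhyp n ↔ ∑ j, v j = 0 := by
  simp [Nhyp, LinearMap.mem_ker, LinearMap.sum_apply]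

lemma Qmat_mulVec_of_mem {n : ℕ} {v : Fin n → ℝ} (hv : v ∈ Nhyp n) : Qmat n *ᵥ v = v := by
  have : Pmat n *ᵥ v = 0 := by
    ext i
    rw [Pmat_mulVec_apply, (mem_Nhyp_iff v).1 hv, zero_div, Pi.zero_apply]
  rw [Qmat_mulVec, this, sub_zero]

lemma Qmat_mulVec_mem {n : ℕ} (hn : n ≠ 0) (v : Fin n → ℝ) : Qmat n *ᵥ v ∈ Nhyp n := by
  have h : Pmat n *ᵥ (Qmat n *ᵥ v) = 0 := by
    rw [mulVec_mulVec, Pmat_mul_Qmat hn, zero_mulVec]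
  have h0 := congrFun h ⟨0, Nat.pos_of_ne_zero hn⟩
  rw [Pmat_mulVec_apply, Pi.zero_apply, div_eq_zero_iff] at h0
  exact (mem_Nhyp_iff _).2 (h0.resolve_right (Nat.cast_ne_zero.2 hn))

lemma Pmat_mulVec_mem_span {n : ℕ} (v : Fin n → ℝ) :
    Pmat n *ᵥ v ∈ Submodule.span ℝ {uvec n} := by
  refine Submodule.mem_span_singleton.2 ⟨√n * ((∑ j, v j) / n), ?_⟩
  ext i
  have hn : (0 : ℝ) < n := by exact_mod_cast (Nat.zero_le _).trans_lt i.2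
  have := (Real.sqrt_pos.2 hn).ne'
  rw [Pmat_mulVec_apply, Pi.smul_apply, uvec, smul_eq_mul]
  field_simp

lemma Qmat_mulVec_uvec {n : ℕ} : Qmat n *ᵥ uvec n = 0 := by
  ext i
  have hn : (n : ℝ) ≠ 0 := by exact_mod_cast ((Nat.zero_le _).trans_lt i.2).ne'
  rw [Qmat_mulVec, Pi.sub_apply, Pmat_mulVec_apply]
  simp only [uvec, Finset.sum_const, Finset.card_univ, Fintype.card_fin, nsmul_eq_mul,
    Pi.zero_apply]
  rw [mul_div_cancel_left₀ _ hn, sub_self]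

lemma mem_span_uvec_sup_iff {n : ℕ} {M : Submodule ℝ (Fin n → ℝ)} (hM : M ≤ Nhyp n)
    (v : Fin n → ℝ) : v ∈ Submodule.span ℝ {uvec n} ⊔ M ↔ Qmat n *ᵥ v ∈ M := by
  refine ⟨fun h => ?_, fun h => ?_⟩
  · obtain ⟨a, ha, y, hy, rfl⟩ := Submodule.mem_sup.1 h
    obtain ⟨c, rfl⟩ := Submodule.mem_span_singleton.1 ha
    rwa [mulVec_add, mulVec_smul, Qmat_mulVec_uvec, smul_zero, zero_add,
      Qmat_mulVec_of_mem (hM hy)]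
  · refine Submodule.mem_sup.2 ⟨_, Pmat_mulVec_mem_span v, _, h, ?_⟩
    rw [Qmat_mulVec, add_sub_cancel]

section Cocycle

variable {n : ℕ} {X : Type*} {f : X → X} {S : X → Matrix (Fin n) (Fin n) ℝ}

lemma cocycle_add (a b : ℕ) (x : X) :
    cocycle f S (a + b) x = cocycle f S a (f^[b] x) * cocycle f S b x := by
  induction a with
  | zero => simp [cocycle]
  | succ a ih =>
    rw [Nat.add_right_comm, cocycle, cocycle, ih, Function.iterate_add_apply, Matrix.mul_assoc]

lemma cocycle_succ_mulVec (k : ℕ) (x : X) (v : Fin n → ℝ) :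
    cocycle f S (k + 1) x *ᵥ v = S (f^[k] x) *ᵥ (cocycle f S k x *ᵥ v) := by
  rw [cocycle, mulVec_mulVec]

lemma continuous_cocycle [TopologicalSpace X] (hf : Continuous f) (hS : Continuous S) (k : ℕ) :
    Continuous (cocycle f S k) := by
  induction k with
  | zero => exact continuous_const
  | succ k ih => exact (hS.comp (hf.iterate k)).mul ih

lemma norm_cocycle_mulVec_le (hS : ∀ x, IsStochastic (S x)) (k : ℕ) (x : X) (v : Fin n → ℝ) :
    ‖cocycle f S k x *ᵥ v‖ ≤ ‖v‖ := by
  induction k with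
  | zero => simp [cocycle]
  | succ k ih =>
    rw [cocycle_succ_mulVec]
    exact ((hS _).norm_mulVec_le _).trans ih

lemma cocycle_mul_Pmat (hS : ∀ x, IsStochastic (S x)) (k : ℕ) (x : X) :
    cocycle f S k x * Pmat n = Pmat n := by
  induction k with
  | zero => simp [cocycle]
  | succ k ih => rw [cocycle, Matrix.mul_assoc, ih, (hS _).mul_Pmat]

lemma cocycle_mulVec_of_Qmat_mulVec_eq_zero (hS : ∀ x, IsStochastic (S x)) (k : ℕ) (x : X)
    {v : Fin n → ℝ} (hv : Qmat n *ᵥ v = 0) : cocycle f S k x *ᵥ v = v := by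
  rw [Qmat_mulVec, sub_eq_zero] at hv
  rw [hv, mulVec_mulVec, cocycle_mul_Pmat hS]

/-- `Q` intertwines a stochastic matrix with its compression `Q S Q`. -/
lemma Qmat_mulVec_mulVec (hn : n ≠ 0) {A : Matrix (Fin n) (Fin n) ℝ} (hA : IsStochastic A)
    (v : Fin n → ℝ) : Qmat n *ᵥ (A *ᵥ v) = (Qmat n * A * Qmat n) *ᵥ (Qmat n *ᵥ v) := by
  rw [← mulVec_mulVec (Qmat n *ᵥ v), Qmat_mulVec_of_mem (Qmat_mulVec_mem hn v), Qmat_mulVec v,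
    mulVec_sub, mulVec_mulVec v (Qmat n * A) (Pmat n), Matrix.mul_assoc,
    hA.mul_Pmat, Qmat_mul_Pmat hn, zero_mulVec, sub_zero, mulVec_mulVec]

/-- `Q` intertwines the cocycle of `S` with the normal cocycle. -/
lemma Qmat_mulVec_cocycle (hn : n ≠ 0) (hS : ∀ x, IsStochastic (S x)) (k : ℕ) (x : X)
    (v : Fin n → ℝ) : Qmat n *ᵥ (cocycle f S k x *ᵥ v) =
      cocycle f (fun y => Qmat n * S y * Qmat n) k x *ᵥ (Qmat n *ᵥ v) := by
  induction k with
  | zero => simp [cocycle]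
  | succ k ih => rw [cocycle_succ_mulVec, cocycle_succ_mulVec, Qmat_mulVec_mulVec hn (hS _), ih]

lemma cocycle_mulVec_mem {N : X → Submodule ℝ (Fin n → ℝ)}
    (h : ∀ x, (N x).map (mulVecLin (S x)) ≤ N (f x)) (k : ℕ) {x : X} {v : Fin n → ℝ}
    (hv : v ∈ N x) : cocycle f S k x *ᵥ v ∈ N (f^[k] x) := by
  induction k with
  | zero => simpa [cocycle] using hv
  | succ k ih =>
    rw [cocycle_succ_mulVec, Function.iterate_succ_apply']
    exact h _ (Submodule.mem_map_of_mem (f := mulVecLin (S (f^[k] x))) ih)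

lemma eq_zero_of_cocycle_mulVec_eq_zero {N : X → Submodule ℝ (Fin n → ℝ)}
    (h : ∀ x, (N x).map (mulVecLin (S x)) ≤ N (f x))
    (hinj : ∀ x, ∀ v ∈ N x, S x *ᵥ v = 0 → v = 0) (k : ℕ) {x : X} {v : Fin n → ℝ}
    (hv : v ∈ N x) (h0 : cocycle f S k x *ᵥ v = 0) : v = 0 := by
  induction k with
  | zero => simpa [cocycle] using h0
  | succ k ih =>
    rw [cocycle_succ_mulVec] at h0
    exact ih (hinj _ _ (cocycle_mulVec_mem h k hv) h0)

lemma norm_mul_norm_le_of_unit {A : Matrix (Fin n) (Fin n) ℝ} {c : ℝ}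
    {N1 N2 : Submodule ℝ (Fin n → ℝ)}
    (h : ∀ w ∈ N2, ∀ v ∈ N1, ‖toE w‖ = 1 → ‖toE v‖ = 1 → ‖toE (A *ᵥ w)‖ ≤ c * ‖toE (A *ᵥ v)‖)
    {w v : Fin n → ℝ} (hw : w ∈ N2) (hv : v ∈ N1) :
    ‖toE (A *ᵥ w)‖ * ‖toE v‖ ≤ c * (‖toE (A *ᵥ v)‖ * ‖toE w‖) := by
  rcases eq_or_ne w 0 with rfl | hw0
  · simp [toE_zero]
  rcases eq_or_ne v 0 with rfl | hv0
  · simp [toE_zero]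
  have pw := norm_toE_pos hw0
  have pv := norm_toE_pos hv0
  have key := h _ (N2.smul_mem ‖toE w‖⁻¹ hw) _ (N1.smul_mem ‖toE v‖⁻¹ hv)
    (by rw [toE_smul, norm_smul, norm_inv, norm_norm, inv_mul_cancel₀ pw.ne'])
    (by rw [toE_smul, norm_smul, norm_inv, norm_norm, inv_mul_cancel₀ pv.ne'])
  rw [mulVec_smul, mulVec_smul, toE_smul, toE_smul, norm_smul, norm_smul, norm_inv, norm_inv,
    norm_norm, norm_norm] at key
  have := mul_le_mul_of_nonneg_right key (mul_pos pw pv).le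
  field_simp at this
  linarith

/-- Domination for one block of length `m` improves geometrically along `j` blocks. -/
lemma domination_iterate {N1 N2 : X → Submodule ℝ (Fin n → ℝ)}
    (h1 : ∀ x, (N1 x).map (mulVecLin (S x)) ≤ N1 (f x))
    (h1inj : ∀ x, ∀ v ∈ N1 x, S x *ᵥ v = 0 → v = 0)
    (h2 : ∀ x, (N2 x).map (mulVecLin (S x)) ≤ N2 (f x)) {m : ℕ} {c : ℝ} (hc : 0 ≤ c)
    (hdom : ∀ x, ∀ w ∈ N2 x, ∀ v ∈ N1 x, ‖toE w‖ = 1 → ‖toE v‖ = 1 →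
      ‖toE (cocycle f S m x *ᵥ w)‖ ≤ c * ‖toE (cocycle f S m x *ᵥ v)‖)
    (j : ℕ) {x : X} {w v : Fin n → ℝ} (hw : w ∈ N2 x) (hv : v ∈ N1 x) :
    ‖toE (cocycle f S (j * m) x *ᵥ w)‖ * ‖toE v‖ ≤
      c ^ j * (‖toE (cocycle f S (j * m) x *ᵥ v)‖ * ‖toE w‖) := by
  rcases eq_or_ne v 0 with rfl | hv0
  · simp [toE_zero]
  induction j with
  | zero => simp [cocycle, mul_comm]
  | succ j ih =>
    have hv' := cocycle_mulVec_mem h1 (j * m) hv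
    have hpos := norm_toE_pos fun h0 =>
      hv0 (eq_zero_of_cocycle_mulVec_eq_zero h1 h1inj (j * m) hv h0)
    have step := norm_mul_norm_le_of_unit (hdom _) (cocycle_mulVec_mem h2 (j * m) hw) hv'
    rw [mulVec_mulVec, mulVec_mulVec, ← cocycle_add, add_comm, ← Nat.succ_mul] at step
    refine le_of_mul_le_mul_right ?_ hpos
    have e1 := mul_le_mul_of_nonneg_right step (norm_nonneg (toE v))
    have e2 := mul_le_mul_of_nonneg_left ih
      (mul_nonneg hc (norm_nonneg (toE (cocycle f S ((j + 1) * m) x *ᵥ v))))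
    rw [pow_succ]
    nlinarith [e1, e2]

end Cocycle

/-- A series of continuous matrix-valued functions on a space, dominated column by column by
a summable sequence, has a continuous sum. -/
lemma exists_continuous_matrix_sum {n : ℕ} {X : Type*} [TopologicalSpace X]
    {A : ℕ → X → Matrix (Fin n) (Fin n) ℝ} (hA : ∀ j, Continuous (A j))
    {b : Fin n → ℕ → ℝ} (hb : ∀ k, Summable (b k))
    (hAb : ∀ j x k, ‖A j x *ᵥ Pi.single k 1‖ ≤ b k j) :
    ∃ T : X → Matrix (Fin n) (Fin n) ℝ, Continuous T ∧ ∀ x v,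
      Tendsto (fun K => (∑ j ∈ Finset.range K, A j x) *ᵥ v) atTop (𝓝 (T x *ᵥ v)) := by
  have hle : ∀ i k j x, ‖A j x i k‖ ≤ b k j := fun i k j x => by
    refine le_trans ?_ ((norm_le_pi_norm _ i).trans (hAb j x k))
    simp
  refine ⟨fun x => of fun i k => ∑' j, A j x i k, ?_, fun x v => ?_⟩
  · refine continuous_matrix fun i k => ?_
    exact continuous_tsum (fun j => (hA j).matrix_elem i k) (hb k) (hle i k)
  · have : Tendsto (fun K => ∑ j ∈ Finset.range K, A j x) atTop
        (𝓝 (of fun i k => ∑' j, A j x i k)) := by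
      refine tendsto_pi_nhds.2 fun i => tendsto_pi_nhds.2 fun k => ?_
      have := (Summable.of_norm_bounded (hb k) fun j => hle i k j x).hasSum.tendsto_sum_nat
      simpa only [Matrix.sum_apply, of_apply] using this
    exact ((continuous_id.matrix_mulVec continuous_const).tendsto _).comp this

/-- Over a compact metric space `Λ`, a homeomorphism `f` and a continuous
stochastic cocycle `S`, a dominated splitting `N = N¹ ⊕ N²` for the normal cocycle
`Ŝ_x = Q S_x Q` lifts to a dominated splitting `ℝⁿ = F¹ ⊕ F²` for `S`, where
`F¹_x = ℝu ⊕ N¹_x` and `F²_x ⊆ ℝu ⊕ N²_x`. -/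
theorem stmt2 {n : ℕ} (hn : 2 ≤ n) {Λ : Type*} [MetricSpace Λ] [CompactSpace Λ]
    (f : Λ ≃ₜ Λ) (S : Λ → Matrix (Fin n) (Fin n) ℝ) (hScont : Continuous S)
    (hS : ∀ x, IsStochastic (S x))
    (N1 N2 : Λ → Submodule ℝ (Fin n → ℝ))
    (hN1ne : ∀ x, N1 x ≠ ⊥) (hN2ne : ∀ x, N2 x ≠ ⊥)
    (hsup : ∀ x, N1 x ⊔ N2 x = Nhyp n) (hdisj : ∀ x, N1 x ⊓ N2 x = ⊥)
    -- (i) `Ŝ_x(N¹_x) = N¹_{f(x)}` and `Ŝ_x` is injective on `N¹_x`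
    (h1 : ∀ x, (N1 x).map (Matrix.mulVecLin (Qmat n * S x * Qmat n)) = N1 (f x))
    (h1inj : ∀ x, ∀ v ∈ N1 x, (Qmat n * S x * Qmat n).mulVec v = 0 → v = 0)
    -- (ii) `Ŝ_x(N²_x) ⊆ N²_{f(x)}`
    (h2 : ∀ x, (N2 x).map (Matrix.mulVecLin (Qmat n * S x * Qmat n)) ≤ N2 (f x))
    -- (iii) the projection of `N` onto `N¹_x` along `N²_x` depends continuously on `x`
    (hcont : ∃ π : Λ → Matrix (Fin n) (Fin n) ℝ, Continuous π ∧
      ∀ x, (∀ v ∈ N1 x, (π x).mulVec v = v) ∧ (∀ v ∈ N2 x, (π x).mulVec v = 0))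
    -- (iv) `m`-domination: `sup_{w ∈ N², ‖w‖=1} ‖Ŝ^m w‖ ≤ (1/2) inf_{v ∈ N¹, ‖v‖=1} ‖Ŝ^m v‖`
    (m : ℕ) (hdom : ∀ x, ∀ w ∈ N2 x, ∀ v ∈ N1 x, ‖toE w‖ = 1 → ‖toE v‖ = 1 →
      ‖toE ((cocycle (⇑f) (fun y => Qmat n * S y * Qmat n) m x).mulVec w)‖ ≤
        (1/2) * ‖toE ((cocycle (⇑f) (fun y => Qmat n * S y * Qmat n) m x).mulVec v)‖) :
    ∃ F2 : Λ → Submodule ℝ (Fin n → ℝ),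
      -- `F²_x ⊆ ℝu ⊕ N²_x`
      (∀ x, F2 x ≤ Submodule.span ℝ {uvec n} ⊔ N2 x) ∧
      -- `ℝⁿ = F¹_x ⊕ F²_x` with `F¹_x = ℝu ⊕ N¹_x`
      (∀ x, IsCompl (Submodule.span ℝ {uvec n} ⊔ N1 x) (F2 x)) ∧
      -- `S_x(F¹_x) ⊆ F¹_{f(x)}`
      (∀ x, (Submodule.span ℝ {uvec n} ⊔ N1 x).map (Matrix.mulVecLin (S x)) ≤
          Submodule.span ℝ {uvec n} ⊔ N1 (f x)) ∧
      -- `S_x(F²_x) ⊆ F²_{f(x)}`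
      (∀ x, (F2 x).map (Matrix.mulVecLin (S x)) ≤ F2 (f x)) ∧
      -- the projection of `ℝⁿ` onto `F²_x` along `F¹_x` depends continuously on `x`
      (∃ π : Λ → Matrix (Fin n) (Fin n) ℝ, Continuous π ∧
        ∀ x, (∀ v ∈ F2 x, (π x).mulVec v = v) ∧
          (∀ v ∈ Submodule.span ℝ {uvec n} ⊔ N1 x, (π x).mulVec v = 0)) ∧
      -- `m′`-domination of `F¹ ⊕ F²` with `S^{m′}` injective on `F¹`
      (∃ m' : ℕ, ∀ x,
        (∀ v ∈ Submodule.span ℝ {uvec n} ⊔ N1 x,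
          (cocycle (⇑f) S m' x).mulVec v = 0 → v = 0) ∧
        ∀ w ∈ F2 x, ∀ v ∈ Submodule.span ℝ {uvec n} ⊔ N1 x,
          ‖toE w‖ = 1 → ‖toE v‖ = 1 →
          ‖toE ((cocycle (⇑f) S m' x).mulVec w)‖ ≤
            (1/2) * ‖toE ((cocycle (⇑f) S m' x).mulVec v)‖) := by
  have hn0 : n ≠ 0 := by omega
  obtain ⟨ρ, hρ, hρN⟩ := hcont
  have hN1 : ∀ x, N1 x ≤ Nhyp n := fun x => hsup x ▸ le_sup_left
  have hN2 : ∀ x, N2 x ≤ Nhyp n := fun x => hsup x ▸ le_sup_right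
  have h1' : ∀ x, (N1 x).map (Matrix.mulVecLin (Qmat n * S x * Qmat n)) ≤ N1 (f x) :=
    fun x => (h1 x).le
  have memF1 := fun x => mem_span_uvec_sup_iff (hN1 x)
  have memF2 := fun x => mem_span_uvec_sup_iff (hN2 x)
  -- `R x` is the projection onto `N2 x` along `ℝu ⊕ N1 x`
  obtain ⟨R, hR⟩ : ∃ R : Λ → Matrix (Fin n) (Fin n) ℝ, R = fun x => (1 - ρ x) * Qmat n :=
    ⟨_, rfl⟩
  have hRcont : Continuous R := hR ▸ (continuous_const.sub hρ).mul continuous_const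
  have hRv : ∀ x v, R x *ᵥ v = Qmat n *ᵥ v - ρ x *ᵥ (Qmat n *ᵥ v) := fun x v => by
    simp only [hR]
    rw [← mulVec_mulVec, sub_mulVec, one_mulVec]
  have hR1 : ∀ x v, Qmat n *ᵥ v ∈ N1 x → R x *ᵥ v = 0 := fun x v hv => by
    rw [hRv, (hρN x).1 _ hv, sub_self]
  have hR2 : ∀ x v, Qmat n *ᵥ v ∈ N2 x → R x *ᵥ v = Qmat n *ᵥ v := fun x v hv => by
    rw [hRv, (hρN x).2 _ hv, sub_zero]
  have hRsplit : ∀ x v, R x *ᵥ v ∈ N2 x ∧ Qmat n *ᵥ v - R x *ᵥ v ∈ N1 x := fun x v => by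
    have hv := Qmat_mulVec_mem hn0 v
    rw [← hsup x] at hv
    obtain ⟨a, ha, b, hb, hab⟩ := Submodule.mem_sup.1 hv
    have : R x *ᵥ v = b := by
      rw [hRv, ← hab, mulVec_add, (hρN x).1 a ha, (hρN x).2 b hb, add_zero, add_sub_cancel_left]
    rw [this, ← hab, add_sub_cancel_right]
    exact ⟨hb, ha⟩
  have hQR : ∀ x v, Qmat n *ᵥ (R x *ᵥ v) = R x *ᵥ v := fun x v =>
    Qmat_mulVec_of_mem (hN2 x (hRsplit x v).1)
  have hQS := fun k x v => Qmat_mulVec_cocycle (f := f) hn0 hS k x v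
  have hSle := fun k x v => norm_cocycle_mulVec_le (f := f) hS k x v
  have hSfix := fun k x (v : Fin n → ℝ) =>
    cocycle_mulVec_of_Qmat_mulVec_eq_zero (f := f) hS k x (v := v)
  -- domination and decay in the sup norm
  have hsq : √(n : ℝ) * √n = n := Real.mul_self_sqrt (Nat.cast_nonneg n)
  have dom : ∀ j x, ∀ w ∈ N2 x, ∀ v ∈ N1 x,
      ‖cocycle f (fun y => Qmat n * S y * Qmat n) (j * m) x *ᵥ w‖ * ‖v‖ ≤ n * (1 / 2) ^ j *
        (‖cocycle f (fun y => Qmat n * S y * Qmat n) (j * m) x *ᵥ v‖ * ‖w‖) := by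
    intro j x w hw v hv
    have key := domination_iterate h1' h1inj h2 (by norm_num) hdom j hw hv
    calc _ ≤ _ := mul_le_mul (norm_le_norm_toE _) (norm_le_norm_toE _) (norm_nonneg _)
          (norm_nonneg _)
      _ ≤ _ := key
      _ ≤ (1 / 2) ^ j * (√n * ‖cocycle f (fun y => Qmat n * S y * Qmat n) (j * m) x *ᵥ v‖ *
            (√n * ‖w‖)) := by
          gcongr
          · exact norm_toE_le _
          · exact norm_toE_le _
      _ = (√n * √n) * (1 / 2) ^ j *
            (‖cocycle f (fun y => Qmat n * S y * Qmat n) (j * m) x *ᵥ v‖ * ‖w‖) := by ring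
      _ = _ := by rw [hsq]
  have decay : ∀ j x, ∀ w ∈ N2 x,
      ‖cocycle f (fun y => Qmat n * S y * Qmat n) (j * m) x *ᵥ w‖ ≤
        2 * n * (1 / 2) ^ j * ‖w‖ := by
    intro j x w hw
    obtain ⟨v, hv, hv0⟩ := (N1 x).ne_bot_iff.1 (hN1ne x)
    have key := dom j x w hw v hv
    have hle : ‖cocycle f (fun y => Qmat n * S y * Qmat n) (j * m) x *ᵥ v‖ ≤ 2 * ‖v‖ := by
      have := norm_Qmat_mulVec_le hn0 (cocycle f S (j * m) x *ᵥ v)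
      rw [hQS, Qmat_mulVec_of_mem (hN1 x hv)] at this
      linarith [hSle (j * m) x v]
    refine le_of_mul_le_mul_right (key.trans ?_) (norm_pos_iff.2 hv0)
    calc _ ≤ n * (1 / 2) ^ j * (2 * ‖v‖ * ‖w‖) := by gcongr
      _ = _ := by ring
  -- `T x`, the projection onto `F2 x` along `F1 x`, as a telescoping series
  let A : ℕ → Λ → Matrix (Fin n) (Fin n) ℝ := fun j x =>
    cocycle f S (j * m) x * R x - cocycle f S ((j + 1) * m) x * R x
  have hSc := fun k => continuous_cocycle (f := f) f.continuous hScont k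
  have hAcont : ∀ j, Continuous (A j) := fun j =>
    ((hSc _).mul hRcont).sub ((hSc _).mul hRcont)
  have hRbd : ∀ k : Fin n, ∃ C, ∀ x, ‖R x *ᵥ Pi.single k 1‖ ≤ C := fun k => by
    obtain ⟨C, hC⟩ := isCompact_univ.exists_bound_of_continuousOn
      (hRcont.matrix_mulVec (continuous_const (y := Pi.single k 1))).continuousOn
    exact ⟨C, fun x => hC x (Set.mem_univ x)⟩
  choose C hC using hRbd
  have hAle : ∀ j x k, ‖A j x *ᵥ Pi.single k 1‖ ≤ 4 * n * C k * (1 / 2) ^ j := by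
    intro j x k
    set r := R x *ᵥ Pi.single k 1 with hr
    set y := cocycle f S (j * m) x *ᵥ r with hy
    have hQy : Qmat n *ᵥ y = cocycle f (fun y => Qmat n * S y * Qmat n) (j * m) x *ᵥ r := by
      rw [hy, hQS, hr, hQR]
    have e : A j x *ᵥ Pi.single k 1 =
        Qmat n *ᵥ y - cocycle f S m (f^[j * m] x) *ᵥ (Qmat n *ᵥ y) := by
      have h3 := hSfix m (f^[j * m] x) (Pmat n *ᵥ y)
        (by rw [mulVec_mulVec, Qmat_mul_Pmat hn0, zero_mulVec])
      simp only [A]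
      rw [sub_mulVec, ← mulVec_mulVec, ← mulVec_mulVec, Nat.succ_mul, add_comm (j * m) m,
        cocycle_add, ← hr, ← mulVec_mulVec, ← hy, Qmat_mulVec, mulVec_sub, h3]
      abel
    have hd := decay j x r (hRsplit x _).1
    rw [e]
    calc _ ≤ ‖Qmat n *ᵥ y‖ + ‖Qmat n *ᵥ y‖ :=
          (norm_sub_le _ _).trans (add_le_add_right (hSle _ _ _) _)
      _ ≤ 2 * (2 * n * (1 / 2) ^ j * ‖r‖) := by rw [hQy]; linarith
      _ ≤ 2 * (2 * n * (1 / 2) ^ j * C k) := by gcongr; exact hC k x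
      _ = _ := by ring
  obtain ⟨T, hTcont, hT⟩ := exists_continuous_matrix_sum hAcont
    (fun k => summable_geometric_two.mul_left (4 * n * C k)) hAle
  have hSR : ∀ x v, Tendsto (fun j => cocycle f S (j * m) x *ᵥ (R x *ᵥ v)) atTop
      (𝓝 (R x *ᵥ v - T x *ᵥ v)) := by
    intro x v
    refine ((hT x v).const_sub (R x *ᵥ v)).congr fun K => ?_
    simp only [A]
    rw [Finset.sum_range_sub' (fun j => cocycle f S (j * m) x * R x), sub_mulVec,
      ← mulVec_mulVec, ← mulVec_mulVec, Nat.zero_mul, cocycle, one_mulVec, sub_sub_cancel]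
  have hQT : ∀ x v, Qmat n *ᵥ (R x *ᵥ v - T x *ᵥ v) = 0 := by
    intro x v
    have l1 := ((continuous_const.matrix_mulVec continuous_id).tendsto _ :
      Tendsto (fun z => Qmat n *ᵥ z) (𝓝 (R x *ᵥ v - T x *ᵥ v)) _).comp (hSR x v)
    refine tendsto_nhds_unique l1 (squeeze_zero_norm (fun j => ?_) ?_
      (a := fun j => 2 * n * ‖R x *ᵥ v‖ * (1 / 2) ^ j))
    · rw [Function.comp_apply, id, hQS, hQR]
      linarith [decay j x _ (hRsplit x v).1]
    · simpa using (tendsto_pow_atTop_nhds_zero_of_lt_one (r := (1 / 2 : ℝ)) (by norm_num)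
        (by norm_num)).const_mul (2 * n * ‖R x *ᵥ v‖)
  have hQT' : ∀ x v, Qmat n *ᵥ (T x *ᵥ v) = R x *ᵥ v := fun x v => by
    have := hQT x v
    rw [mulVec_sub, hQR, sub_eq_zero] at this
    exact this.symm
  have hTle : ∀ x v, ‖T x *ᵥ v‖ ≤ 2 * ‖R x *ᵥ v‖ := by
    intro x v
    have : ‖R x *ᵥ v - T x *ᵥ v‖ ≤ ‖R x *ᵥ v‖ :=
      le_of_tendsto (hSR x v).norm (Eventually.of_forall fun j => hSle _ _ _)
    have h3 := norm_sub_le (R x *ᵥ v) (R x *ᵥ v - T x *ᵥ v)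
    rw [sub_sub_cancel] at h3
    linarith
  have hT0 : ∀ x v, Qmat n *ᵥ v ∈ N1 x → T x *ᵥ v = 0 := fun x v hv => by
    have := hTle x v
    rw [hR1 x v hv, norm_zero, mul_zero] at this
    exact norm_le_zero_iff.1 this
  let F2 : Λ → Submodule ℝ (Fin n → ℝ) := fun x =>
    { carrier := {z | Qmat n *ᵥ z ∈ N2 x ∧
        Tendsto (fun j => cocycle f S (j * m) x *ᵥ z) atTop (𝓝 0)}
      zero_mem' := by simp
      add_mem' := fun {a b} ha hb => ⟨by rw [mulVec_add]; exact add_mem ha.1 hb.1, by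
        simpa [mulVec_add] using ha.2.add hb.2⟩
      smul_mem' := fun c {a} ha => ⟨by rw [mulVec_smul]; exact (N2 x).smul_mem c ha.1, by
        simpa [mulVec_smul] using ha.2.const_smul c⟩ }
  have memF2' : ∀ x z, z ∈ F2 x ↔ Qmat n *ᵥ z ∈ N2 x ∧
      Tendsto (fun j => cocycle f S (j * m) x *ᵥ z) atTop (𝓝 0) := fun x z => Iff.rfl
  have hTF2 : ∀ x v, T x *ᵥ v ∈ F2 x := by
    intro x v
    refine (memF2' x _).2 ⟨by rw [hQT']; exact (hRsplit x v).1, ?_⟩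
    have := (hSR x v).sub_const (R x *ᵥ v - T x *ᵥ v)
    rw [sub_self] at this
    refine this.congr fun j => ?_
    conv_lhs => rw [← hSfix (j * m) x _ (hQT x v)]
    rw [← mulVec_sub, sub_sub_cancel]
  have hTid : ∀ x, ∀ z ∈ F2 x, T x *ᵥ z = z := by
    intro x z hz
    have hd : z - T x *ᵥ z ∈ F2 x := sub_mem hz (hTF2 x z)
    have hQd : Qmat n *ᵥ (z - T x *ᵥ z) = 0 := by
      rw [mulVec_sub, hQT', hR2 x z hz.1, sub_self]
    have h0 := tendsto_nhds_unique hd.2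
      (tendsto_const_nhds.congr fun j => (hSfix (j * m) x _ hQd).symm)
    exact (sub_eq_zero.1 h0.symm).symm
  have hF2inv : ∀ x, (F2 x).map (Matrix.mulVecLin (S x)) ≤ F2 (f x) := by
    rintro x _ ⟨z, hz, rfl⟩
    rw [mulVecLin_apply]
    refine (memF2' _ _).2 ⟨?_, ?_⟩
    · rw [Qmat_mulVec_mulVec hn0 (hS x)]
      exact h2 x (Submodule.mem_map_of_mem
        (f := mulVecLin (Qmat n * S x * Qmat n)) hz.1)
    · refine squeeze_zero_norm (fun j => ?_) (tendsto_norm_zero.comp hz.2)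
      have e : cocycle f S (j * m) (f x) *ᵥ (S x *ᵥ z) =
          S (f^[j * m] x) *ᵥ (cocycle f S (j * m) x *ᵥ z) := by
        rw [← cocycle_succ_mulVec, cocycle_add, ← mulVec_mulVec]
        simp [cocycle]
      rw [e]
      exact (hS _).norm_mulVec_le _
  refine ⟨F2, fun x z hz => (memF2 x z).2 hz.1, fun x => ⟨?_, ?_⟩, ?_, hF2inv,
    ⟨T, hTcont, fun x => ⟨hTid x, fun v hv => hT0 x v ((memF1 x v).1 hv)⟩⟩, ?_⟩
  · refine Submodule.disjoint_def.2 fun v hv1 hv2 => ?_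
    rw [← hTid x v hv2, hT0 x v ((memF1 x v).1 hv1)]
  · refine codisjoint_iff.2 (Submodule.eq_top_iff'.2 fun v => ?_)
    refine Submodule.mem_sup.2 ⟨v - T x *ᵥ v, (memF1 x _).2 ?_, T x *ᵥ v, hTF2 x v,
      sub_add_cancel _ _⟩
    rw [mulVec_sub, hQT']
    exact (hRsplit x v).2
  · rintro x _ ⟨v, hv, rfl⟩
    rw [mulVecLin_apply, memF1, Qmat_mulVec_mulVec hn0 (hS x)]
    exact h1' x (Submodule.mem_map_of_mem
      (f := mulVecLin (Qmat n * S x * Qmat n)) ((memF1 x v).1 hv))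
  · obtain ⟨j, hj⟩ := exists_pow_lt_of_lt_one (x := 1 / (48 * (n : ℝ) ^ 2)) (by positivity)
      (show (1 / 2 : ℝ) < 1 by norm_num)
    refine ⟨j * m, fun x => ⟨fun v hv h0 => ?_, fun w hw v hv hw1 hv1 => ?_⟩⟩
    · have hQv : Qmat n *ᵥ v = 0 := by
        refine eq_zero_of_cocycle_mulVec_eq_zero h1' h1inj (j * m) ((memF1 x v).1 hv) ?_
        rw [← hQS, h0, mulVec_zero]
      rw [← hSfix (j * m) x v hQv, h0]
    · set z := cocycle f S (j * m) x *ᵥ w with hz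
      set y := cocycle f S (j * m) x *ᵥ v with hy
      have hzF : z ∈ F2 (f^[j * m] x) := cocycle_mulVec_mem hF2inv (j * m) hw
      have b1 : ‖z‖ ≤ 2 * ‖Qmat n *ᵥ z‖ := by
        have := hTle (f^[j * m] x) z
        rwa [hTid _ z hzF, hR2 _ z hzF.1] at this
      have b2 := decay j x _ hw.1
      have b3 := dom j x _ hw.1 _ ((memF1 x v).1 hv)
      rw [← hQS, ← hz] at b2 b3
      rw [← hQS, ← hy] at b3
      have b4 : ‖v‖ ≤ ‖y‖ + 2 * ‖Qmat n *ᵥ v‖ := by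
        have e : v = y - cocycle f S (j * m) x *ᵥ (Qmat n *ᵥ v) + Qmat n *ᵥ v := by
          have h3 := hSfix (j * m) x (Pmat n *ᵥ v)
            (by rw [mulVec_mulVec, Qmat_mul_Pmat hn0, zero_mulVec])
          rw [Qmat_mulVec, mulVec_sub, h3, ← hy]
          abel
        have t1 := norm_add_le (y - cocycle f S (j * m) x *ᵥ (Qmat n *ᵥ v)) (Qmat n *ᵥ v)
        rw [← e] at t1
        linarith [norm_sub_le y (cocycle f S (j * m) x *ᵥ (Qmat n *ᵥ v)),
          hSle (j * m) x (Qmat n *ᵥ v)]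
      have b5 := norm_Qmat_mulVec_le hn0 y
      have b6 := norm_Qmat_mulVec_le hn0 w
      have b7 : ‖w‖ ≤ 1 := hw1 ▸ norm_le_norm_toE w
      have key : ‖z‖ * ‖v‖ ≤ 24 * n * (1 / 2) ^ j * ‖y‖ := by
        calc ‖z‖ * ‖v‖ ≤ 2 * ‖Qmat n *ᵥ z‖ * (‖y‖ + 2 * ‖Qmat n *ᵥ v‖) := by gcongr
          _ = 2 * ‖Qmat n *ᵥ z‖ * ‖y‖ + 4 * (‖Qmat n *ᵥ z‖ * ‖Qmat n *ᵥ v‖) := by ring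
          _ ≤ 2 * (2 * n * (1 / 2) ^ j * ‖Qmat n *ᵥ w‖) * ‖y‖ +
              4 * (n * (1 / 2) ^ j * (‖Qmat n *ᵥ y‖ * ‖Qmat n *ᵥ w‖)) := by gcongr
          _ ≤ 2 * (2 * n * (1 / 2) ^ j * (2 * 1)) * ‖y‖ +
              4 * (n * (1 / 2) ^ j * (2 * ‖y‖ * (2 * 1))) := by
              have b8 : ‖Qmat n *ᵥ w‖ ≤ 2 * 1 := by linarith
              gcongr
          _ = _ := by ring
      calc ‖toE z‖ = ‖toE z‖ * ‖toE v‖ := by rw [hv1, mul_one]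
        _ ≤ (√n * ‖z‖) * (√n * ‖v‖) :=
            mul_le_mul (norm_toE_le _) (norm_toE_le _) (norm_nonneg _) (by positivity)
        _ = n * (‖z‖ * ‖v‖) := by nth_rw 3 [← hsq]; ring
        _ ≤ n * (24 * n * (1 / 2) ^ j * ‖y‖) := by gcongr
        _ ≤ n * (24 * n * (1 / (48 * (n : ℝ) ^ 2)) * ‖toE y‖) := by
            gcongr
            exact norm_le_norm_toE y
        _ = 1 / 2 * ‖toE y‖ := by
            have : (n : ℝ) ≠ 0 := Nat.cast_ne_zero.2 hn0
            field_simp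
            ring
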